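/- arXiv:2108.12774 — 2 statements merged into one kernel-verified Lean document; each statement's English description precedes it below -/
import Mathlib

section
/- Let Q be a set of states, V an alphabet, T ⊆ Q^6, and let g, g' : Q → Language(V) be such that letterSets(g(q)) = letterSets(g'(q)) for all q ∈ Q. Then letterSets(F(g)(q)) = letterSets(F(g')(q)) for all q ∈ Q; i.e., the operator F is well defined on K-equivalence classes, so its iteration can be computed on representatives. -/
/-- The operator `F` associated to a set `T` of transitions (a head state and five
successor states) and acting on exit-weight functions `g : Q → Language V`. -/
def Fop {Q V : Type} (T : Set (Q × Q × Q × Q × Q × Q)) (g : Q → Language V) :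
    Q → Language V := fun q =>
  g q ⊔ ⨆ t ∈ T, ⨆ (_ : t.1 = q),
    g t.2.1 * g t.2.2.1 * g t.2.2.2.1 * g t.2.2.2.2.1 * g t.2.2.2.2.2

/-- The set of letter-sets of the words of a language. -/
def letterSets {V : Type} [DecidableEq V] (L : Language V) : Set (Finset V) :=
  (fun w : List V => w.toFinset) '' L

theorem letterSets_sup {V : Type} [DecidableEq V] (L M : Language V) :
    letterSets (L ⊔ M) = letterSets L ∪ letterSets M :=
  Set.image_union _ _ _

theorem letterSets_iSup {V : Type} [DecidableEq V] {ι : Sort*} (L : ι → Language V) :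
    letterSets (⨆ i, L i) = ⋃ i, letterSets (L i) :=
  Set.image_iUnion

theorem letterSets_mul {V : Type} [DecidableEq V] (L M : Language V) :
    letterSets (L * M) = Set.image2 (· ∪ ·) (letterSets L) (letterSets M) :=
  Set.image_image2_distrib fun _ _ => List.toFinset_append

/-- The operator `F` is well defined on K-equivalence classes: if `g` and `g'`
have pointwise the same letter-sets, then so do `F(g)` and `F(g')`. -/
theorem Fop_respects_letterSets {Q V : Type} [DecidableEq V]
    (T : Set (Q × Q × Q × Q × Q × Q)) (g g' : Q → Language V)
    (h : ∀ q : Q, letterSets (g q) = letterSets (g' q)) :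
    ∀ q : Q, letterSets (Fop T g q) = letterSets (Fop T g' q) := by
  intro q
  simp only [Fop, letterSets_sup, letterSets_iSup, letterSets_mul, h]
end

section
/- Let S be a nonempty finite set of symbols of an alphabet Σ. Then the set of words whose letter-set is exactly S equals the union, over all duplicate-free words σ whose letter-set is S (i.e., over all orderings of S), of the languages L(σ); moreover this union is disjoint: every word w with letter-set S lies in L(σ) for exactly one such σ, namely σ = firstOcc(w). (This justifies deciding monomial entailment by guessing an ordering of the variables of the monomial.) -/
open Computability

/-- `firstOcc w` is the duplicate-free word listing the distinct symbols of `w`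
in the order of their first occurrence in `w`. -/
def firstOcc {α : Type} [DecidableEq α] (w : List α) : List α :=
  w.reverse.dedup.reverse

/-- The star `(⋃_{s ∈ seen} {s})*` of the union of the singleton languages of
the symbols in the list `seen`. -/
def seenStar {α : Type} [DecidableEq α] (seen : List α) : Language α :=
  (⨆ s ∈ seen, ({[s]} : Language α))∗

/-- `LsigAux seen σ` is `{σ1}·(seen∪{σ1})*·{σ2}·(seen∪{σ1,σ2})*·…`, accumulating
seen symbols. -/
def LsigAux {α : Type} [DecidableEq α] : List α → List α → Language α
  | _, [] => 1
  | seen, s :: rest => {[s]} * seenStar (s :: seen) * LsigAux (s :: seen) rest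

/-- For a duplicate-free word `σ = σ1⋯σk`, `Lsig σ` is the language
`{σ1}⁺·{σ2}·({σ1}∪{σ2})*·{σ3}·({σ1}∪{σ2}∪{σ3})*·⋯·{σk}·({σ1}∪⋯∪{σk})*`. -/
def Lsig {α : Type} [DecidableEq α] (σ : List α) : Language α :=
  LsigAux [] σ

theorem dedup_append_singleton {α : Type} [DecidableEq α] (l : List α) (a : α) :
    (l ++ [a]).dedup = l.dedup.filter (fun x => x ≠ a) ++ [a] := by
  induction l with
  | nil => simp
  | cons b l ih =>
    by_cases hb : b ∈ l
    · rw [List.cons_append, List.dedup_cons_of_mem (by simp [hb]), ih,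
        List.dedup_cons_of_mem hb]
    · by_cases hba : b = a
      · subst hba
        rw [List.cons_append, List.dedup_cons_of_mem (by simp), ih,
          List.dedup_cons_of_notMem hb]
        simp
      · rw [List.cons_append, List.dedup_cons_of_notMem (by simp [hb, hba]), ih,
          List.dedup_cons_of_notMem hb]
        simp [hba]

theorem firstOcc_cons {α : Type} [DecidableEq α] (a : α) (w : List α) :
    firstOcc (a :: w) = a :: (firstOcc w).filter (fun x => x ≠ a) := by
  rw [firstOcc, List.reverse_cons, dedup_append_singleton, List.reverse_append,
    ← List.filter_reverse, firstOcc]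
  rfl

theorem nodup_firstOcc {α : Type} [DecidableEq α] (w : List α) : (firstOcc w).Nodup :=
  List.nodup_reverse.2 (List.nodup_dedup _)

theorem toFinset_firstOcc {α : Type} [DecidableEq α] (w : List α) :
    (firstOcc w).toFinset = w.toFinset := by
  ext x
  simp [firstOcc]

theorem filter_firstOcc_cons_of_mem {α : Type} [DecidableEq α] {seen : List α} {a : α}
    (ha : a ∈ seen) (w : List α) :
    (firstOcc (a :: w)).filter (fun x => x ∉ seen) =
      (firstOcc w).filter (fun x => x ∉ seen) := by
  rw [firstOcc_cons, List.filter_cons_of_neg (by simpa using ha), List.filter_filter]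
  refine List.filter_congr fun x _ => ?_
  by_cases hx : x = a <;> simp_all

theorem filter_firstOcc_cons_of_notMem {α : Type} [DecidableEq α] {seen : List α} {a : α}
    (ha : a ∉ seen) (w : List α) :
    (firstOcc (a :: w)).filter (fun x => x ∉ seen) =
      a :: (firstOcc w).filter (fun x => x ∉ a :: seen) := by
  rw [firstOcc_cons, List.filter_cons_of_pos (by simpa using ha), List.filter_filter]
  congr 1
  refine List.filter_congr fun x _ => ?_
  by_cases hx : x = a <;> simp_all

theorem filter_firstOcc_append {α : Type} [DecidableEq α] {seen u : List α}
    (hu : ∀ x ∈ u, x ∈ seen) (w : List α) :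
    (firstOcc (u ++ w)).filter (fun x => x ∉ seen) =
      (firstOcc w).filter (fun x => x ∉ seen) := by
  induction u with
  | nil => rfl
  | cons a u ih =>
    rw [List.cons_append, filter_firstOcc_cons_of_mem (hu a (by simp)),
      ih fun x hx => hu x (by simp [hx])]

theorem mem_iSup_singleton {α : Type} (seen w : List α) :
    w ∈ (⨆ s ∈ seen, ({[s]} : Language α)) ↔ ∃ s ∈ seen, w = [s] := by
  change w ∈ (⨆ s ∈ seen, ({[s]} : Set (List α))) ↔ _
  simp only [Set.iSup_eq_iUnion, Set.mem_iUnion, Set.mem_singleton_iff, exists_prop]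

theorem mem_seenStar {α : Type} [DecidableEq α] {seen w : List α} :
    w ∈ seenStar seen ↔ ∀ x ∈ w, x ∈ seen := by
  rw [seenStar, Language.mem_kstar]
  constructor
  · rintro ⟨L, rfl, hL⟩ x hx
    obtain ⟨y, hy, hxy⟩ := List.mem_flatten.1 hx
    obtain ⟨s, hs, rfl⟩ := (mem_iSup_singleton seen y).1 (hL y hy)
    rwa [List.mem_singleton.1 hxy]
  · intro h
    refine ⟨w.map fun x => [x], by rw [← List.flatMap_def, List.flatMap_singleton'], fun y hy => ?_⟩
    obtain ⟨x, hx, rfl⟩ := List.mem_map.1 hy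
    exact (mem_iSup_singleton seen _).2 ⟨x, h x hx, rfl⟩

theorem filter_firstOcc_of_mem_LsigAux {α : Type} [DecidableEq α] {σ seen w : List α}
    (hσ : σ.Nodup) (hd : ∀ x ∈ σ, x ∉ seen) (hw : w ∈ LsigAux seen σ) :
    (firstOcc w).filter (fun x => x ∉ seen) = σ := by
  induction σ generalizing seen w with
  | nil =>
    rw [LsigAux, Language.mem_one] at hw
    subst hw
    simp [firstOcc]
  | cons s σ ih =>
    rw [LsigAux, mul_assoc] at hw
    obtain ⟨t, rfl, y, hy, rfl⟩ := Language.mem_mul.1 hw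
    obtain ⟨u, hu, v, hv, rfl⟩ := Language.mem_mul.1 hy
    obtain ⟨hs, hσ⟩ := List.nodup_cons.1 hσ
    rw [List.singleton_append, filter_firstOcc_cons_of_notMem (hd s (by simp)),
      filter_firstOcc_append (mem_seenStar.1 hu), ih hσ _ hv]
    intro x hx
    rw [List.mem_cons, not_or]
    exact ⟨fun h => hs (h ▸ hx), hd x (by simp [hx])⟩

theorem mem_seenStar_mul_LsigAux {α : Type} [DecidableEq α] (seen w : List α) :
    w ∈ seenStar seen * LsigAux seen ((firstOcc w).filter (fun x => x ∉ seen)) := by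
  induction w generalizing seen with
  | nil =>
    exact Language.mem_mul.2 ⟨[], mem_seenStar.2 (by simp), [],
      by simp [firstOcc, LsigAux], rfl⟩
  | cons a w ih =>
    by_cases ha : a ∈ seen
    · rw [filter_firstOcc_cons_of_mem ha]
      obtain ⟨u, hu, v, hv, huv⟩ := Language.mem_mul.1 (ih seen)
      refine Language.mem_mul.2 ⟨a :: u, mem_seenStar.2 ?_, v, hv, by rw [← huv]; rfl⟩
      exact List.forall_mem_cons.2 ⟨ha, mem_seenStar.1 hu⟩
    · rw [filter_firstOcc_cons_of_notMem ha, LsigAux, mul_assoc]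
      exact Language.mem_mul.2 ⟨[], mem_seenStar.2 (by simp), a :: w,
        Language.mem_mul.2 ⟨[a], rfl, w, ih (a :: seen), rfl⟩, rfl⟩

theorem mem_Lsig_firstOcc {α : Type} [DecidableEq α] (w : List α) :
    w ∈ Lsig (firstOcc w) := by
  obtain ⟨u, hu, v, hv, rfl⟩ := Language.mem_mul.1 (mem_seenStar_mul_LsigAux [] w)
  have hnil : u = [] :=
    List.eq_nil_iff_forall_not_mem.2 fun x hx => List.not_mem_nil (mem_seenStar.1 hu x hx)
  subst hnil
  simpa [Lsig] using hv

theorem firstOcc_eq_of_mem_Lsig {α : Type} [DecidableEq α] {σ w : List α}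
    (hσ : σ.Nodup) (hw : w ∈ Lsig σ) : firstOcc w = σ := by
  simpa using filter_firstOcc_of_mem_LsigAux hσ (by simp) hw

/-- For a nonempty finite set `S` of symbols, the set of words with letter-set
exactly `S` is the union of the languages `Lsig σ` over all duplicate-free words
`σ` with letter-set `S`, and this union is disjoint: a word `w` with letter-set `S`
lies in `Lsig σ` for exactly one such `σ`, namely `σ = firstOcc w`. -/
theorem letterSet_eq_union_Lsig {α : Type} [DecidableEq α] (S : Finset α)
    (hS : S.Nonempty) :
    ({w : List α | w.toFinset = S} =
        ⋃ σ ∈ {σ : List α | σ.Nodup ∧ σ.toFinset = S}, (Lsig σ : Set (List α))) ∧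
    (∀ w : List α, w.toFinset = S → ∀ σ : List α, σ.Nodup → σ.toFinset = S →
        (w ∈ Lsig σ ↔ σ = firstOcc w)) := by
  refine ⟨?_, fun w _ σ hσ _ => ⟨fun h => (firstOcc_eq_of_mem_Lsig hσ h).symm, ?_⟩⟩
  · refine Set.ext fun w => Iff.trans ?_ Set.mem_iUnion₂.symm
    constructor
    · intro hw
      exact ⟨firstOcc w, ⟨nodup_firstOcc w, (toFinset_firstOcc w).trans hw⟩,
        mem_Lsig_firstOcc w⟩
    · rintro ⟨σ, ⟨hσ, rfl⟩, hw⟩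
      change w.toFinset = σ.toFinset
      rw [← toFinset_firstOcc w, firstOcc_eq_of_mem_Lsig hσ hw]
  · rintro rfl
    exact mem_Lsig_firstOcc w
end
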